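/- Let $\Bbbk$ be a field and suppose $(C(n))_{n \geq 1}$ is a sequence of chain complexes of $\Bbbk$-vector spaces satisfying the tempered condition: for every $\kappa \geq 0$ there exists $n_\kappa$ such that $H_k(C(n)) = 0$ for all $n \geq n_\kappa$ and all $k \leq \kappa$. Then for every finite dimensional chain complex $V$ concentrated in degrees $\leq 0$ and every degree $k \in \mathbb{Z}$, there are only finitely many $n$ such that $H_k\big(\mathrm{Hom}(C(n), V^{\otimes n})\big) \neq 0$, provided each $C(n)$ is degree-wise finite dimensional and bounded below. -/

import Mathlib

open DirectSum

/-- The degree-`d` component of the `n`-th tensor power of a graded vector space. -/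
noncomputable abbrev gradedTensorPower (𝕜 : Type) [Field 𝕜] (V : ℤ → Type)
    [∀ d, AddCommGroup (V d)] [∀ d, Module 𝕜 (V d)] (n : ℕ) (d : ℤ) : Type :=
  ⨁ (g : {g : Fin n → ℤ // (∑ j, g j) = d}), PiTensorProduct 𝕜 (fun j => V (g.1 j))

/-- Every linear map over a field has a generalized inverse. -/
theorem LinearMap.exists_generalizedInverse {𝕜 M N : Type*} [Field 𝕜] [AddCommGroup M]
    [Module 𝕜 M] [AddCommGroup N] [Module 𝕜 N] (f : M →ₗ[𝕜] N) :
    ∃ s : N →ₗ[𝕜] M, ∀ x, f (s (f x)) = f x := by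
  obtain ⟨r, hr⟩ := f.rangeRestrict.exists_rightInverse_of_surjective f.range_rangeRestrict
  obtain ⟨s, hs⟩ := LinearMap.exists_extend r
  refine ⟨s, fun x => ?_⟩
  have hsx : s (f x) = r (f.rangeRestrict x) := LinearMap.congr_fun hs (f.rangeRestrict x)
  rw [hsx]
  exact congrArg Subtype.val (LinearMap.congr_fun hr (f.rangeRestrict x))

/-- A chain complex over a field admits a degree-one map which is a contracting homotopy in every
degree where the complex is exact. -/
theorem exists_partial_contraction {𝕜 : Type*} [Field 𝕜] {C : ℤ → Type*}
    [∀ i, AddCommGroup (C i)] [∀ i, Module 𝕜 (C i)] (δ : ∀ i : ℤ, C (i + 1) →ₗ[𝕜] C i)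
    (hδ : ∀ (i : ℤ) (x : C (i + 1 + 1)), δ i (δ (i + 1) x) = 0) :
    ∃ s : ∀ i : ℤ, C i →ₗ[𝕜] C (i + 1), ∀ i : ℤ,
      (∀ x : C (i + 1), δ i x = 0 → ∃ y, δ (i + 1) y = x) →
        ∀ x : C (i + 1), δ (i + 1) (s (i + 1) x) + s i (δ i x) = x := by
  choose σ hσ using fun i => (δ i).exists_generalizedInverse
  have hp : ∀ m : ℤ, ∃ p : C m →ₗ[𝕜] C m, ∀ (i : ℤ) (e : i + 1 = m),
      p = e ▸ (LinearMap.id - σ i ∘ₗ δ i) := by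
    intro m
    obtain ⟨i, rfl⟩ : ∃ i, i + 1 = m := ⟨m - 1, by omega⟩
    refine ⟨LinearMap.id - σ i ∘ₗ δ i, fun j e => ?_⟩
    obtain rfl : j = i := by omega
    rfl
  choose p hp using hp
  have hp_apply (i : ℤ) (x : C (i + 1)) : p (i + 1) x = x - σ i (δ i x) := by
    rw [hp (i + 1) i rfl]
    rfl
  have hp_boundary (i : ℤ) (x : C (i + 1)) : p i (δ i x) = δ i x := by
    obtain ⟨j, rfl⟩ : ∃ j, i = j + 1 := ⟨i - 1, by omega⟩
    rw [hp_apply, hδ, map_zero, sub_zero]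
  refine ⟨fun i => σ i ∘ₗ p i, fun i hi x => ?_⟩
  obtain ⟨y, hy⟩ := hi (p (i + 1) x) (by rw [hp_apply, map_sub, hσ, sub_self])
  simp only [LinearMap.comp_apply, hp_boundary]
  rw [← hy, hσ, hy, hp_apply, sub_add_cancel]

theorem PiTensorProduct.subsingleton_of_factor {ι R : Type*} [CommSemiring R] {M : ι → Type*}
    [∀ i, AddCommMonoid (M i)] [∀ i, Module R (M i)] (i : ι) [Subsingleton (M i)] :
    Subsingleton (PiTensorProduct R M) := by
  refine subsingleton_of_forall_eq 0 fun x => ?_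
  induction x using PiTensorProduct.induction_on with
  | smul_tprod r f =>
    rw [(PiTensorProduct.tprod R).map_coord_zero i (Subsingleton.elim (f i) 0), smul_zero]
  | add x y hx hy => rw [hx, hy, add_zero]

theorem gradedTensorPower.subsingleton_of_pos {𝕜 : Type} [Field 𝕜] {V : ℤ → Type}
    [∀ d, AddCommGroup (V d)] [∀ d, Module 𝕜 (V d)]
    (hV : ∀ j : ℤ, 0 < j → Subsingleton (V j)) (n : ℕ) {d : ℤ} (hd : 0 < d) :
    Subsingleton (gradedTensorPower 𝕜 V n d) := by
  refine subsingleton_of_forall_eq 0 fun x => DFinsupp.ext fun g => ?_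
  obtain ⟨j, hj⟩ : ∃ j, 0 < g.1 j := by
    by_contra! h
    exact hd.not_ge (g.2 ▸ Finset.sum_nonpos fun j _ => h j)
  have := hV _ hj
  have := PiTensorProduct.subsingleton_of_factor (R := 𝕜) (M := fun j => V (g.1 j)) j
  exact Subsingleton.elim _ _

/-- Let `(C(n))` be a tempered family of chain complexes (for every
`κ ≥ 0` there is `n_κ` with `H_k(C(n)) = 0` for all `n ≥ n_κ` and `k ≤ κ`), each
degree-wise finite dimensional and bounded below, and let `V` be a finite dimensional
chain complex concentrated in degrees `≤ 0`.  Then for every degree `d` only finitely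
many `n` have `H_d(Hom(C(n), V^{⊗n})) ≠ 0`.  Here `T n` is (a graded vector space
identified degree-wise with) `V^{⊗n}`, equipped with its differential `dT`; the
degree-`d` component of the internal hom complex `Hom(C(n), T n)` consists of the
families `g m t : C(n)_m →ₗ T(n)_t` (`t = m + d`), a cycle being a family commuting
with the differentials up to the sign `(-1)^d` and a boundary being a family of the
form `∂h = dT ∘ h - (-1)^{d+1} h ∘ dC`; nonvanishing of `H_d` means that some cycle
is not a boundary. -/
theorem stmt_12 (𝕜 : Type) [Field 𝕜]
    (C : ℕ → ℤ → Type) [∀ n i, AddCommGroup (C n i)] [∀ n i, Module 𝕜 (C n i)]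
    (dC : ∀ (n : ℕ) (i : ℤ), C n (i + 1) →ₗ[𝕜] C n i)
    (hdC : ∀ (n : ℕ) (i : ℤ) (x : C n (i + 1 + 1)), dC n i (dC n (i + 1) x) = 0)
    (hfdC : ∀ n i, FiniteDimensional 𝕜 (C n i))
    (hbb : ∀ n : ℕ, ∃ b : ℤ, ∀ i : ℤ, i < b → Subsingleton (C n i))
    (htempered : ∀ κ : ℤ, 0 ≤ κ → ∃ nκ : ℕ, ∀ n : ℕ, nκ ≤ n → ∀ i : ℤ, i + 1 ≤ κ →
      ∀ x : C n (i + 1), dC n i x = 0 → ∃ y : C n (i + 1 + 1), dC n (i + 1) y = x)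
    (V : ℤ → Type) [∀ j, AddCommGroup (V j)] [∀ j, Module 𝕜 (V j)]
    (dV : ∀ j : ℤ, V (j + 1) →ₗ[𝕜] V j)
    (hdV : ∀ (j : ℤ) (x : V (j + 1 + 1)), dV j (dV (j + 1) x) = 0)
    (hfdV : ∀ j, FiniteDimensional 𝕜 (V j))
    (hsuppV : {j : ℤ | ∃ v : V j, v ≠ 0}.Finite)
    (hconcV : ∀ j : ℤ, 0 < j → Subsingleton (V j))
    (T : ℕ → ℤ → Type) [∀ n j, AddCommGroup (T n j)] [∀ n j, Module 𝕜 (T n j)]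
    (eT : ∀ n j, T n j ≃ₗ[𝕜] gradedTensorPower 𝕜 V n j)
    (dT : ∀ (n : ℕ) (j : ℤ), T n (j + 1) →ₗ[𝕜] T n j)
    (hdT : ∀ (n : ℕ) (j : ℤ) (x : T n (j + 1 + 1)), dT n j (dT n (j + 1) x) = 0) :
    ∀ d : ℤ, {n : ℕ |
      ∃ g : ∀ (m t : ℤ), t = m + d → (C n m →ₗ[𝕜] T n t),
        (∀ (m : ℤ) (x : C n (m + 1)),
          dT n (m + d) (g (m + 1) (m + d + 1) (by omega) x) =
            (d.negOnePow : ℤ) • g m (m + d) rfl (dC n m x)) ∧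
        ¬ ∃ h : ∀ (m t : ℤ), t = m + (d + 1) → (C n m →ₗ[𝕜] T n t),
          ∀ (m : ℤ) (x : C n (m + 1)),
            g (m + 1) (m + 1 + d) (by omega) x =
              dT n (m + 1 + d) (h (m + 1) (m + 1 + d + 1) (by omega) x) -
                ((d + 1).negOnePow : ℤ) • h m (m + 1 + d) (by omega) (dC n m x)}.Finite := by
  intro d
  obtain ⟨N, hN⟩ := htempered (max 0 (-d)) (le_max_left _ _)
  refine (Set.finite_lt_nat N).subset ?_
  rintro n ⟨g, hg, hgh⟩
  by_contra hn
  refine hgh ?_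
  obtain ⟨s, hs⟩ := exists_partial_contraction (dC n) (hdC n)
  refine ⟨fun m t ht => (d.negOnePow : ℤ) • (g (m + 1) t (by omega) ∘ₗ s m), fun m x => ?_⟩
  by_cases hm : m + 1 ≤ -d
  · have hx := hs m (hN n (not_lt.mp hn) m (hm.trans (le_max_right _ _))) x
    have hsq : (d.negOnePow : ℤ) * (d.negOnePow : ℤ) = 1 := by
      rw [← Units.val_mul, Int.units_mul_self, Units.val_one]
    simp only [LinearMap.smul_apply, LinearMap.comp_apply, map_zsmul, hg (m + 1),
      Int.negOnePow_succ, Units.val_neg, smul_smul, neg_mul, hsq, neg_smul, sub_neg_eq_add, one_smul]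
    rw [← map_add, hx]
  · have := gradedTensorPower.subsingleton_of_pos (𝕜 := 𝕜) hconcV n (d := m + 1 + d) (by omega)
    have := (eT n (m + 1 + d)).injective.subsingleton
    exact Subsingleton.elim _ _
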